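/- arXiv:2106.12704 — 6 statements merged into one kernel-verified Lean document; each statement's English description precedes it below -/
import Mathlib

section
/- Let f : ℝⁿ → ℝᵐ be a strongly convex mapping. Then the problem of minimizing f is C⁰ weakly simplicial; that is, there exists a continuous map φ : Δ^{m−1} → X*(f) such that φ(Δ_I) = X*(f_I) for every non-empty subset I of {1,…,m}. -/
open scoped BigOperators

/-- `f` is strongly convex with convexity parameter `α`. -/
def StrongConvexWith {n : ℕ} (α : ℝ) (f : EuclideanSpace ℝ (Fin n) → ℝ) : Prop :=
  ∀ x y : EuclideanSpace ℝ (Fin n), ∀ t ∈ Set.Icc (0 : ℝ) 1,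
    f (t • x + (1 - t) • y) ≤
      t * f x + (1 - t) * f y - α / 2 * t * (1 - t) * ‖x - y‖ ^ 2

/-- The Pareto set of the subproblem of `f : ℝⁿ → ℝᵐ` given by the components with
indices in `I`: points `x` such that there is no `y` with `fᵢ(y) ≤ fᵢ(x)` for all
`i ∈ I` and `fⱼ(y) < fⱼ(x)` for some `j ∈ I`. -/
def ParetoSetOn {n m : ℕ} (f : EuclideanSpace ℝ (Fin n) → Fin m → ℝ)
    (I : Finset (Fin m)) : Set (EuclideanSpace ℝ (Fin n)) :=
  {x | ¬ ∃ y, (∀ i ∈ I, f y i ≤ f x i) ∧ ∃ j ∈ I, f y j < f x j}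

/-- The face `Δ_I` of the standard simplex `Δ^{m−1}`. -/
def simplexFace (m : ℕ) (I : Finset (Fin m)) : Set (Fin m → ℝ) :=
  {w ∈ stdSimplex ℝ (Fin m) | ∀ i ∉ I, w i = 0}

lemma scw_convexOn {n : ℕ} {α : ℝ} (hα : 0 < α) {g : EuclideanSpace ℝ (Fin n) → ℝ}
    (hg : StrongConvexWith α g) : ConvexOn ℝ Set.univ g := by
  refine ⟨convex_univ, ?_⟩
  intro x _ y _ a b ha hb hab
  obtain rfl : b = 1 - a := by linarith
  have h := hg x y a ⟨ha, by linarith⟩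
  have : 0 ≤ α / 2 * a * (1 - a) * ‖x - y‖ ^ 2 := by positivity
  simp only [smul_eq_mul]
  linarith

lemma scw_continuous {n : ℕ} {α : ℝ} (hα : 0 < α) {g : EuclideanSpace ℝ (Fin n) → ℝ}
    (hg : StrongConvexWith α g) : Continuous g := by
  have := (scw_convexOn hα hg).continuousOn isOpen_univ
  exact continuousOn_univ.mp this

lemma scw_exists_min {n : ℕ} {α : ℝ} (hα : 0 < α) {g : EuclideanSpace ℝ (Fin n) → ℝ}
    (hg : StrongConvexWith α g) : ∃ x, ∀ y, g x ≤ g y := by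
  have hc := scw_continuous hα hg
  obtain ⟨p, hp, hpm⟩ := (isCompact_closedBall (0 : EuclideanSpace ℝ (Fin n)) 1).exists_isMinOn
    ⟨0, by simp⟩ hc.continuousOn
  have hpm' : ∀ z : EuclideanSpace ℝ (Fin n), ‖z‖ ≤ 1 → g p ≤ g z := fun z hz =>
    hpm (by simpa using hz)
  set C := g 0 - g p with hC
  have hC0 : 0 ≤ C := by have := hpm' 0 (by simp); linarith
  set R := 1 + 2 * C / α with hR
  have hR1 : 1 ≤ R := by have : 0 ≤ 2 * C / α := by positivity
                         linarith
  obtain ⟨q, hq, hqm⟩ := (isCompact_closedBall (0 : EuclideanSpace ℝ (Fin n)) R).exists_isMinOn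
    ⟨0, by simp; linarith⟩ hc.continuousOn
  have hqm' : ∀ z : EuclideanSpace ℝ (Fin n), ‖z‖ ≤ R → g q ≤ g z := fun z hz =>
    hqm (by simpa using hz)
  refine ⟨q, fun y => ?_⟩
  by_cases hy : ‖y‖ ≤ R
  · exact hqm' y hy
  push Not at hy
  have h0 := hqm' 0 (by simp; linarith)
  set r := ‖y‖ with hr
  have hr0 : 0 < r := by linarith
  have h := hg y 0 r⁻¹ ⟨by positivity, inv_le_one_of_one_le₀ (by linarith)⟩
  simp only [smul_zero, add_zero, sub_zero, ← hr] at h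
  have h1 := hpm' (r⁻¹ • y) (by rw [norm_smul, norm_inv, norm_norm, inv_mul_cancel₀ hr0.ne'])
  have h2 : r * g p ≤ g y + (r - 1) * g 0 - α / 2 * (r - 1) * r := by
    have := mul_le_mul_of_nonneg_left (h1.trans h) hr0.le
    refine this.trans (le_of_eq ?_)
    field_simp
  have h3 : 2 * C ≤ α * (r - 1) := by
    have : 2 * C / α ≤ r - 1 := by linarith
    rw [div_le_iff₀ hα] at this
    linarith
  have h4 : 0 ≤ r * (α * (r - 1) - 2 * C) := mul_nonneg hr0.le (by linarith)
  have : g 0 ≤ g y := by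
    rw [hC] at h4
    nlinarith
  linarith

lemma scw_quad {n : ℕ} {α : ℝ} {g : EuclideanSpace ℝ (Fin n) → ℝ}
    (hg : StrongConvexWith α g) {x : EuclideanSpace ℝ (Fin n)} (hx : ∀ y, g x ≤ g y)
    (y : EuclideanSpace ℝ (Fin n)) : α / 4 * ‖y - x‖ ^ 2 ≤ g y - g x := by
  have h := hg y x (1 / 2) ⟨by norm_num, by norm_num⟩
  have := hx ((1 / 2 : ℝ) • y + (1 - 1 / 2 : ℝ) • x)
  nlinarith

lemma scw_sum {n m : ℕ} {α : ℝ} {f : EuclideanSpace ℝ (Fin n) → Fin m → ℝ}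
    (hf : ∀ i, StrongConvexWith α (fun x => f x i)) {w : Fin m → ℝ}
    (hw : w ∈ stdSimplex ℝ (Fin m)) : StrongConvexWith α (fun x => ∑ i, w i * f x i) := by
  intro x y t ht
  calc ∑ i, w i * f (t • x + (1 - t) • y) i
      ≤ ∑ i, w i * (t * f x i + (1 - t) * f y i - α / 2 * t * (1 - t) * ‖x - y‖ ^ 2) :=
        Finset.sum_le_sum fun i _ => mul_le_mul_of_nonneg_left (hf i x y t ht) (hw.1 i)
    _ = ∑ i, (t * (w i * f x i) + (1 - t) * (w i * f y i)
          - w i * (α / 2 * t * (1 - t) * ‖x - y‖ ^ 2)) :=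
        Finset.sum_congr rfl fun i _ => by ring
    _ = _ := by
        rw [Finset.sum_sub_distrib, Finset.sum_add_distrib, ← Finset.mul_sum, ← Finset.mul_sum,
          ← Finset.sum_mul, hw.2, one_mul]

lemma scw_common {n m : ℕ} {f : EuclideanSpace ℝ (Fin n) → Fin m → ℝ}
    (hconv : ∀ i, ∃ α > (0 : ℝ), StrongConvexWith α (fun x => f x i)) :
    ∃ α > (0 : ℝ), ∀ i, StrongConvexWith α (fun x => f x i) := by
  choose a ha hs using hconv
  obtain ⟨α, hα, hle⟩ : ∃ α > (0 : ℝ), ∀ i, α ≤ a i := by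
    rcases isEmpty_or_nonempty (Fin m) with h | h
    · exact ⟨1, one_pos, fun i => (h.false i).elim⟩
    · obtain ⟨j, hj⟩ := Finite.exists_min a
      exact ⟨a j, ha j, hj⟩
  refine ⟨α, hα, fun i x y t ht => (hs i x y t ht).trans ?_⟩
  have h1 : 0 ≤ t * (1 - t) * ‖x - y‖ ^ 2 :=
    mul_nonneg (mul_nonneg ht.1 (by linarith [ht.2])) (by positivity)
  have := mul_le_mul_of_nonneg_right (hle i) h1
  nlinarith

lemma pareto_of_min {n m : ℕ} {α : ℝ} (hα : 0 < α) {f : EuclideanSpace ℝ (Fin n) → Fin m → ℝ}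
    (hf : ∀ i, StrongConvexWith α (fun x => f x i)) {w : Fin m → ℝ} {I : Finset (Fin m)}
    (hw : w ∈ simplexFace m I) {x : EuclideanSpace ℝ (Fin n)}
    (hx : ∀ y, ∑ i, w i * f x i ≤ ∑ i, w i * f y i) : x ∈ ParetoSetOn f I := by
  rintro ⟨y, hy, j, -, hj⟩
  have hq := scw_quad (scw_sum hf hw.1) hx y
  have hle : ∑ i, w i * f y i ≤ ∑ i, w i * f x i := by
    refine Finset.sum_le_sum fun i _ => ?_
    by_cases hi : i ∈ I
    · exact mul_le_mul_of_nonneg_left (hy i hi) (hw.1.1 i)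
    · simp [hw.2 i hi]
  have h0 : ‖y - x‖ ^ 2 = 0 := by
    have : 0 ≤ ‖y - x‖ ^ 2 := by positivity
    nlinarith
  have : y = x := by simpa [sub_eq_zero] using h0
  subst this
  exact lt_irrefl _ hj

lemma exists_weight {n m : ℕ} {f : EuclideanSpace ℝ (Fin n) → Fin m → ℝ}
    (hf : ∀ i, ConvexOn ℝ Set.univ (fun x => f x i)) {I : Finset (Fin m)} (hI : I.Nonempty)
    {x : EuclideanSpace ℝ (Fin n)} (hx : x ∈ ParetoSetOn f I) :
    ∃ w ∈ simplexFace m I, ∀ y, ∑ i, w i * f x i ≤ ∑ i, w i * f y i := by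
  set S : Set (Fin m → ℝ) := {z | ∃ y, ∀ i ∈ I, f y i - f x i < z i} with hS
  have hSo : IsOpen S := by
    have : S = ⋃ y, ⋂ i ∈ I, {z : Fin m → ℝ | f y i - f x i < z i} := by
      ext z; simp [hS]
    rw [this]
    refine isOpen_iUnion fun y => isOpen_biInter_finset fun i _ => ?_
    exact isOpen_lt continuous_const (continuous_apply i)
  have hSc : Convex ℝ S := by
    rintro z ⟨y, hy⟩ z' ⟨y', hy'⟩ a b ha hb hab
    refine ⟨a • y + b • y', fun i hi => ?_⟩
    have h := (hf i).2 (Set.mem_univ y) (Set.mem_univ y') ha hb hab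
    simp only [smul_eq_mul] at h
    have h1 := hy i hi
    have h2 := hy' i hi
    simp only [Pi.add_apply, Pi.smul_apply, smul_eq_mul]
    have h3 : a * (f y i - f x i) + b * (f y' i - f x i) < a * z i + b * z' i := by
      rcases ha.eq_or_lt with rfl | ha'
      · have : b = 1 := by linarith
        subst this; linarith
      · have := mul_lt_mul_of_pos_left h1 ha'
        have := mul_le_mul_of_nonneg_left h2.le hb
        linarith
    have h4 : a * f x i + b * f x i = f x i := by rw [← add_mul, hab, one_mul]
    linarith
  have hS0 : (0 : Fin m → ℝ) ∉ S := by
    rintro ⟨y, hy⟩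
    obtain ⟨j, hj⟩ := hI
    refine hx ⟨y, fun i hi => ?_, j, hj, ?_⟩
    · have := hy i hi
      simp only [Pi.zero_apply] at this
      linarith
    · have := hy j hj
      simp only [Pi.zero_apply] at this
      linarith
  obtain ⟨l, hl⟩ := geometric_hahn_banach_open_point hSc hSo hS0
  rw [map_zero] at hl
  set c : Fin m → ℝ := fun i => l (Pi.single i 1) with hc
  have hlz : ∀ z, l z = ∑ i, c i * z i := by
    intro z
    conv_lhs => rw [pi_eq_sum_univ' z]
    rw [map_sum]
    refine Finset.sum_congr rfl fun i _ => ?_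
    rw [map_smul, smul_eq_mul, mul_comm, hc]
  have hsum : ∑ i, c i < 0 := by
    have := hl (fun _ => 1) ⟨x, fun i _ => by simp⟩
    rw [hlz] at this
    simpa using this
  have hpert : ∀ i (s : ℝ), (i ∈ I → 0 ≤ s) → ∑ j, c j + c i * s < 0 := by
    intro i s hs
    have := hl ((fun _ => 1) + Pi.single i s) ⟨x, fun j hj => by
      by_cases hij : j = i
      · subst hij
        have := hs hj
        simp; linarith
      · simp [hij]⟩
    rw [hlz] at this
    simpa [mul_add, Finset.sum_add_distrib, Pi.single_apply] using this
  have hcnp : ∀ i, c i ≤ 0 := by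
    intro i
    by_contra h
    push Not at h
    have h1 := hpert i (-(∑ j, c j) / c i) fun _ => div_nonneg (by linarith) h.le
    rw [mul_div_cancel₀ _ h.ne'] at h1
    linarith
  have hc0 : ∀ i ∉ I, c i = 0 := by
    intro i hi
    by_contra h
    have h1 := hpert i (-(∑ j, c j) / c i) fun h' => (hi h').elim
    rw [mul_div_cancel₀ _ h] at h1
    linarith
  have hmin : ∀ y, ∑ i, c i * (f y i - f x i) ≤ 0 := by
    intro y
    by_contra h
    push Not at h
    set T := ∑ i, c i * (f y i - f x i)
    set ε := T / (-(∑ i, c i)) with hε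
    have hε0 : 0 < ε := div_pos h (by linarith)
    have := hl (fun i => f y i - f x i + ε) ⟨y, fun i _ => by linarith⟩
    rw [hlz] at this
    simp only [mul_add, Finset.sum_add_distrib, ← Finset.sum_mul] at this
    have h2 : (∑ i, c i) * ε = -T := by
      rw [hε]; field_simp [hsum.ne]
    rw [h2] at this
    change T + -T < 0 at this
    linarith
  refine ⟨fun i => c i / ∑ j, c j, ⟨⟨fun i => div_nonneg_of_nonpos (hcnp i) hsum.le, ?_⟩,
    fun i hi => by simp [hc0 i hi]⟩, fun y => ?_⟩
  · rw [← Finset.sum_div, div_self hsum.ne]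
  · have h := hmin y
    have h1 := div_nonneg_of_nonpos h hsum.le
    rw [Finset.sum_div] at h1
    rw [← sub_nonneg, ← Finset.sum_sub_distrib]
    refine h1.trans (le_of_eq (Finset.sum_congr rfl fun i _ => by ring))

lemma argmin_continuousOn {n m : ℕ} {α : ℝ} (hα : 0 < α)
    {f : EuclideanSpace ℝ (Fin n) → Fin m → ℝ}
    (hf : ∀ i, StrongConvexWith α (fun x => f x i)) (φ : (Fin m → ℝ) → EuclideanSpace ℝ (Fin n))
    (hφ : ∀ w ∈ stdSimplex ℝ (Fin m), ∀ y, ∑ i, w i * f (φ w) i ≤ ∑ i, w i * f y i) :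
    ContinuousOn φ (stdSimplex ℝ (Fin m)) := by
  have hmin : ∀ i, ∃ b, ∀ y, b ≤ f y i := fun i =>
    let ⟨x, hx⟩ := scw_exists_min hα (hf i)
    ⟨f x i, hx⟩
  choose b hb using hmin
  intro w₀ hw₀
  set x₀ := φ w₀ with hx₀
  -- uniform bound on the minimizers
  set K := ∑ i, (f x₀ i - b i) with hK
  have hbd : ∀ w ∈ stdSimplex ℝ (Fin m), α / 4 * ‖x₀ - φ w‖ ^ 2 ≤ K := by
    intro w hw
    refine (scw_quad (scw_sum hf hw) (hφ w hw) x₀).trans ?_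
    rw [← Finset.sum_sub_distrib, hK]
    refine Finset.sum_le_sum fun i _ => ?_
    have h1 : w i ≤ 1 := by
      rw [← hw.2]
      exact Finset.single_le_sum (fun j _ => hw.1 j) (Finset.mem_univ i)
    have h0 := hw.1 i
    have h2 := hb i (φ w)
    have h3 := hb i x₀
    nlinarith
  have hball : ∀ w ∈ stdSimplex ℝ (Fin m),
      φ w ∈ Metric.closedBall x₀ (Real.sqrt (4 * K / α)) := by
    intro w hw
    rw [Metric.mem_closedBall, dist_comm, dist_eq_norm]
    apply Real.le_sqrt_of_sq_le
    rw [le_div_iff₀ hα]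
    have := hbd w hw
    linarith
  have hB : ∀ i, ∃ B, ∀ w ∈ stdSimplex ℝ (Fin m), |f x₀ i - f (φ w) i| ≤ B := by
    intro i
    have hc : Continuous fun x => f x₀ i - f x i :=
      continuous_const.sub (scw_continuous hα (hf i))
    obtain ⟨B, hB⟩ := (isCompact_closedBall x₀ (Real.sqrt (4 * K / α))).exists_bound_of_continuousOn
      hc.continuousOn
    exact ⟨B, fun w hw => by simpa using hB _ (hball w hw)⟩
  choose B hB using hB
  have hest : ∀ w ∈ stdSimplex ℝ (Fin m),
      dist (φ w) x₀ ≤ Real.sqrt (2 / α * ∑ i, |w i - w₀ i| * B i) := by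
    intro w hw
    apply Real.le_sqrt_of_sq_le
    have h1 := scw_quad (scw_sum hf hw) (hφ w hw) x₀
    have h2 := scw_quad (scw_sum hf hw₀) (hφ w₀ hw₀) (φ w)
    simp only [← hx₀] at h1 h2
    rw [norm_sub_rev] at h1
    have h3 : (∑ i, w i * f x₀ i - ∑ i, w i * f (φ w) i)
        + (∑ i, w₀ i * f (φ w) i - ∑ i, w₀ i * f x₀ i) ≤ ∑ i, |w i - w₀ i| * B i := by
      rw [← Finset.sum_sub_distrib, ← Finset.sum_sub_distrib, ← Finset.sum_add_distrib]
      refine Finset.sum_le_sum fun i _ => ?_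
      calc _ = (w i - w₀ i) * (f x₀ i - f (φ w) i) := by ring
        _ ≤ |(w i - w₀ i) * (f x₀ i - f (φ w) i)| := le_abs_self _
        _ = |w i - w₀ i| * |f x₀ i - f (φ w) i| := abs_mul _ _
        _ ≤ _ := mul_le_mul_of_nonneg_left (hB i w hw) (abs_nonneg _)
    rw [dist_eq_norm, div_mul_eq_mul_div, le_div_iff₀ hα]
    linarith
  have hlim : Filter.Tendsto (fun w : Fin m → ℝ => Real.sqrt (2 / α * ∑ i, |w i - w₀ i| * B i))
      (nhdsWithin w₀ (stdSimplex ℝ (Fin m))) (nhds 0) := by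
    have hc : Continuous (fun w : Fin m → ℝ => Real.sqrt (2 / α * ∑ i, |w i - w₀ i| * B i)) := by
      fun_prop
    have := (hc.tendsto w₀).mono_left (nhdsWithin_le_nhds (s := stdSimplex ℝ (Fin m)))
    simpa using this
  rw [ContinuousWithinAt, tendsto_iff_dist_tendsto_zero]
  refine squeeze_zero' (Filter.Eventually.of_forall fun _ => dist_nonneg) ?_ hlim
  filter_upwards [self_mem_nhdsWithin] with w hw using hest w hw

/-- All unconstrained strongly convex problems are C⁰ weakly simplicial: if
`f : ℝⁿ → ℝᵐ` is strongly convex, then there is a continuous map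
`φ : Δ^{m−1} → X*(f)` with `φ(Δ_I) = X*(f_I)` for every non-empty `I ⊆ {1,…,m}`. -/
theorem stronglyConvex_weakly_simplicial {n m : ℕ}
    (f : EuclideanSpace ℝ (Fin n) → Fin m → ℝ)
    (hconv : ∀ i, ∃ α > (0 : ℝ), StrongConvexWith α (fun x => f x i)) :
    ∃ φ : (Fin m → ℝ) → EuclideanSpace ℝ (Fin n),
      ContinuousOn φ (stdSimplex ℝ (Fin m)) ∧
      Set.MapsTo φ (stdSimplex ℝ (Fin m)) (ParetoSetOn f Finset.univ) ∧
      ∀ I : Finset (Fin m), I.Nonempty →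
        φ '' simplexFace m I = ParetoSetOn f I := by
  obtain ⟨α, hα, hf⟩ := scw_common hconv
  have hex : ∀ w : Fin m → ℝ, ∃ x, w ∈ stdSimplex ℝ (Fin m) →
      ∀ y, ∑ i, w i * f x i ≤ ∑ i, w i * f y i := by
    intro w
    by_cases hw : w ∈ stdSimplex ℝ (Fin m)
    · obtain ⟨x, hx⟩ := scw_exists_min hα (scw_sum hf hw)
      exact ⟨x, fun _ => hx⟩
    · exact ⟨0, fun h => (hw h).elim⟩
  choose φ hφ using hex
  refine ⟨φ, argmin_continuousOn hα hf φ hφ, fun w hw => ?_, fun I hI => ?_⟩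
  · exact pareto_of_min hα hf ⟨hw, fun i hi => (hi (Finset.mem_univ i)).elim⟩ (hφ w hw)
  · apply Set.Subset.antisymm
    · rintro _ ⟨w, hw, rfl⟩
      exact pareto_of_min hα hf hw (hφ w hw.1)
    · intro x hx
      obtain ⟨w, hw, hmin⟩ := exists_weight (fun i => scw_convexOn hα (hf i)) hI hx
      refine ⟨w, hw, ?_⟩
      have hq := scw_quad (scw_sum hf hw.1) hmin (φ w)
      have hle := hφ w hw.1 x
      have h0 : ‖φ w - x‖ ^ 2 = 0 := by
        have : 0 ≤ ‖φ w - x‖ ^ 2 := by positivity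
        nlinarith
      simpa [sub_eq_zero] using h0
end

section
/- Let f = (f₁,…,f_m) : ℝⁿ → ℝᵐ be a convex mapping. If x ∈ X*(f), then there exists (w₁,…,w_m) ∈ Δ^{m−1} such that x is a minimizer of Σᵢ wᵢ fᵢ. -/
open scoped BigOperators

/-- The Pareto set of `f : ℝⁿ → ℝᵐ`: the set of points `x` such that there is no `y`
with `fᵢ(y) ≤ fᵢ(x)` for all `i` and `fⱼ(y) < fⱼ(x)` for some `j`. -/
def ParetoSet {n m : ℕ} (f : EuclideanSpace ℝ (Fin n) → Fin m → ℝ) :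
    Set (EuclideanSpace ℝ (Fin n)) :=
  {x | ¬ ∃ y, (∀ i, f y i ≤ f x i) ∧ ∃ j, f y j < f x j}

/-- If `f : ℝⁿ → ℝᵐ` is a convex mapping and `x ∈ X*(f)`, then there exists a weight
`w ∈ Δ^{m−1}` such that `x` is a minimizer of `Σᵢ wᵢ fᵢ`. -/
theorem pareto_exists_weight {n m : ℕ} (hm : 0 < m)
    (f : EuclideanSpace ℝ (Fin n) → Fin m → ℝ)
    (hconv : ∀ i, ConvexOn ℝ Set.univ (fun x => f x i))
    (x : EuclideanSpace ℝ (Fin n)) (hx : x ∈ ParetoSet f) :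
    ∃ w ∈ stdSimplex ℝ (Fin m), ∀ y, ∑ i, w i * f x i ≤ ∑ i, w i * f y i := by
  set S : Set (Fin m → ℝ) := {z | ∃ y, ∀ i, f y i - f x i < z i} with hS
  have hopen : IsOpen S := by
    have : S = ⋃ y, ⋂ i, {z : Fin m → ℝ | f y i - f x i < z i} := by
      ext z; simp [hS]
    rw [this]
    exact isOpen_iUnion fun y => isOpen_iInter_of_finite fun i =>
      isOpen_lt continuous_const (continuous_apply i)
  have hcvx : Convex ℝ S := by
    rintro z ⟨y, hy⟩ z' ⟨y', hy'⟩ a b ha hb hab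
    refine ⟨a • y + b • y', fun i => ?_⟩
    have h1 := (hconv i).2 (Set.mem_univ y) (Set.mem_univ y') ha hb hab
    simp only [smul_eq_mul] at h1
    have h2 : a * (f y i - f x i) + b * (f y' i - f x i) < a * z i + b * z' i := by
      rcases ha.eq_or_lt with h0 | h0
      · have hb1 : b = 1 := by linarith
        subst hb1
        rw [← h0]
        linarith [hy' i]
      · have := mul_lt_mul_of_pos_left (hy i) h0
        have := mul_le_mul_of_nonneg_left (hy' i).le hb
        linarith
    have h3 : f x i = a * f x i + b * f x i := by rw [← add_mul, hab, one_mul]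
    simp only [Pi.add_apply, Pi.smul_apply, smul_eq_mul]
    linarith
  have h0 : (0 : Fin m → ℝ) ∉ S := by
    rintro ⟨y, hy⟩
    have hy' : ∀ i, f y i < f x i := fun i => by
      have := hy i
      simp only [Pi.zero_apply] at this
      linarith
    exact hx ⟨y, fun i => (hy' i).le, ⟨0, hm⟩, hy' _⟩
  obtain ⟨g, hg⟩ := geometric_hahn_banach_open_point hcvx hopen h0
  simp only [map_zero] at hg
  have hone : g 1 < 0 := hg 1 ⟨x, fun i => by simp⟩
  have hgsum : ∀ z : Fin m → ℝ, g z = ∑ i, z i * g (Pi.single i 1) := by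
    intro z
    conv_lhs => rw [pi_eq_sum_univ' z]
    simp [map_sum]
  have hneg : ∀ i, g (Pi.single i 1) ≤ 0 := by
    intro i
    by_contra! hpos
    have ht : 0 ≤ -g 1 / g (Pi.single i 1) := div_nonneg (by linarith) hpos.le
    have := hg (1 + (-g 1 / g (Pi.single i 1)) • Pi.single i 1) ⟨x, fun j => by
      have h4 : (0 : ℝ) ≤ (Pi.single i 1 : Fin m → ℝ) j := by
        rw [Pi.single_apply]; split_ifs <;> norm_num
      have := mul_nonneg ht h4
      simp only [Pi.add_apply, Pi.smul_apply, smul_eq_mul, Pi.one_apply]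
      linarith⟩
    rw [map_add, map_smul, smul_eq_mul, div_mul_cancel₀ _ hpos.ne'] at this
    linarith
  have hsum1 : ∑ i, g (Pi.single i 1) = g 1 := by rw [hgsum 1]; simp
  have hle : ∀ y, g (f y - f x) ≤ 0 := by
    intro y
    by_contra! hpos
    have hq : 0 < g (f y - f x) / (-g 1) := div_pos hpos (by linarith)
    have := hg (f y - f x + (g (f y - f x) / (-g 1)) • 1) ⟨y, fun j => by
      simpa using hq⟩
    rw [map_add, map_smul, smul_eq_mul] at this
    have h5 : g (f y - f x) / (-g 1) * g 1 = - g (f y - f x) := by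
      field_simp [hone.ne]
    linarith
  refine ⟨fun i => g (Pi.single i 1) / g 1, ⟨fun i => div_nonneg_of_nonpos (hneg i) hone.le, ?_⟩,
    fun y => ?_⟩
  · rw [← Finset.sum_div, hsum1, div_self hone.ne]
  · have key : ∀ z : Fin m → ℝ, ∑ i, g (Pi.single i 1) / g 1 * z i = g z / g 1 := by
      intro z
      rw [hgsum z, Finset.sum_div]
      exact Finset.sum_congr rfl fun i _ => by ring
    rw [key, key]
    have := hle y
    rw [map_sub] at this
    exact div_le_div_of_nonpos_of_le hone.le (by linarith)
end

section
/- Let f : ℝⁿ → ℝᵐ be a strongly convex mapping. Then the Pareto set equals the weak Pareto set: X*(f) = X^w(f). -/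
/-- For a strongly convex mapping `f : ℝⁿ → ℝᵐ`, the Pareto set `X*(f)` equals the
weak Pareto set `X^w(f)`. -/
theorem paretoSet_eq_weakParetoSet {n m : ℕ} (hm : 0 < m)
    (f : EuclideanSpace ℝ (Fin n) → Fin m → ℝ)
    (hconv : ∀ i, ∃ α > (0 : ℝ), StrongConvexWith α (fun x => f x i)) :
    {x : EuclideanSpace ℝ (Fin n) |
        ¬ ∃ y, (∀ i, f y i ≤ f x i) ∧ ∃ j, f y j < f x j} =
      {x : EuclideanSpace ℝ (Fin n) | ¬ ∃ y, ∀ i, f y i < f x i} := by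
  ext x
  simp only [Set.mem_setOf_eq]
  refine not_congr ⟨?_, ?_⟩
  · rintro ⟨y, hle, j, hj⟩
    have hne : y ≠ x := by
      rintro rfl
      exact lt_irrefl _ hj
    have hpos : 0 < ‖y - x‖ ^ 2 := by
      have : 0 < ‖y - x‖ := norm_pos_iff.mpr (sub_ne_zero.mpr hne)
      positivity
    refine ⟨(1 / 2 : ℝ) • y + (1 - 1 / 2 : ℝ) • x, fun i => ?_⟩
    obtain ⟨α, hα, h⟩ := hconv i
    have h2 := h y x (1 / 2) ⟨by norm_num, by norm_num⟩
    have h3 := mul_pos hα hpos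
    have h4 := hle i
    dsimp only at h2
    refine lt_of_le_of_lt h2 ?_
    nlinarith
  · rintro ⟨y, hy⟩
    exact ⟨y, fun i => (hy i).le, ⟨0, hm⟩, hy _⟩
end

section
/- Let f : ℝⁿ → ℝᵐ be a strongly convex mapping. Then the Pareto set X*(f) is a compact subset of ℝⁿ. -/
theorem StrongConvexWith.continuous_of_pos {n : ℕ} {α : ℝ} (hα : 0 < α)
    {g : EuclideanSpace ℝ (Fin n) → ℝ} (h : StrongConvexWith α g) : Continuous g := by
  have hc : ConvexOn ℝ Set.univ g := by
    refine ⟨convex_univ, ?_⟩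
    intro x _ y _ a b ha hb hab
    have hb' : b = 1 - a := by linarith
    subst hb'
    have := h x y a ⟨ha, by linarith⟩
    have h2 : 0 ≤ α / 2 * a * (1 - a) * ‖x - y‖ ^ 2 := by positivity
    simp only [smul_eq_mul]
    linarith
  rw [← continuousOn_univ]
  exact hc.continuousOn isOpen_univ

theorem StrongConvexWith.exists_bound {n : ℕ} {α : ℝ} (hα : 0 < α)
    {g : EuclideanSpace ℝ (Fin n) → ℝ} (h : StrongConvexWith α g) :
    ∃ R : ℝ, ∀ x, g x ≤ g 0 → ‖x‖ ≤ R := by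
  have hg := h.continuous_of_pos hα
  obtain ⟨M, hM⟩ := ((isCompact_closedBall (0 : EuclideanSpace ℝ (Fin n)) 1).image hg).bddBelow
  have hM0 : M ≤ g 0 := hM ⟨0, by simp, rfl⟩
  refine ⟨1 + 2 * (g 0 - M) / α, fun x hx => ?_⟩
  by_cases hr : ‖x‖ ≤ 1
  · have : 0 ≤ 2 * (g 0 - M) / α := div_nonneg (by linarith) hα.le
    linarith
  push Not at hr
  have hr0 : 0 < ‖x‖ := by linarith
  have ht1 : ‖x‖⁻¹ ≤ 1 := inv_le_one_of_one_le₀ hr.le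
  have ht0 : 0 ≤ ‖x‖⁻¹ := by positivity
  have key := h x 0 ‖x‖⁻¹ ⟨ht0, ht1⟩
  have hu : M ≤ g (‖x‖⁻¹ • x + (1 - ‖x‖⁻¹) • 0) := by
    refine hM ⟨_, ?_, rfl⟩
    simp [norm_smul, hr0.ne']
  have e : α / 2 * ‖x‖⁻¹ * (1 - ‖x‖⁻¹) * ‖x - 0‖ ^ 2 = α / 2 * (‖x‖ - 1) := by
    rw [sub_zero]; field_simp
  rw [e] at key
  have h3 : ‖x‖⁻¹ * g x ≤ ‖x‖⁻¹ * g 0 := mul_le_mul_of_nonneg_left hx ht0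
  have h4 : α / 2 * (‖x‖ - 1) ≤ g 0 - M := by linarith
  have h5 : ‖x‖ - 1 ≤ 2 * (g 0 - M) / α := by
    rw [le_div_iff₀ hα]; linarith
  linarith

/-- For a strongly convex mapping `f : ℝⁿ → ℝᵐ`, the Pareto set `X*(f)` is compact. -/
theorem paretoSet_isCompact {n m : ℕ} (hm : 0 < m)
    (f : EuclideanSpace ℝ (Fin n) → Fin m → ℝ)
    (hconv : ∀ i, ∃ α > (0 : ℝ), StrongConvexWith α (fun x => f x i)) :
    IsCompact {x : EuclideanSpace ℝ (Fin n) |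
      ¬ ∃ y, (∀ i, f y i ≤ f x i) ∧ ∃ j, f y j < f x j} := by
  choose α hα hs using hconv
  have hcont : ∀ i, Continuous (fun x => f x i) := fun i => (hs i).continuous_of_pos (hα i)
  have heq : {x : EuclideanSpace ℝ (Fin n) |
      ¬ ∃ y, (∀ i, f y i ≤ f x i) ∧ ∃ j, f y j < f x j} =
      (⋃ y, ⋂ i, {x | f y i < f x i})ᶜ := by
    ext x
    simp only [Set.mem_setOf_eq, Set.mem_compl_iff, Set.mem_iUnion, Set.mem_iInter]
    refine not_congr ⟨?_, ?_⟩
    · rintro ⟨y, hy, j, hj⟩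
      have hxy : x - y ≠ 0 := by
        intro h0
        rw [sub_eq_zero.mp h0] at hj
        exact lt_irrefl _ hj
      refine ⟨(1 / 2 : ℝ) • x + (1 - 1 / 2 : ℝ) • y, fun i => ?_⟩
      have h1 := hs i x y (1 / 2) ⟨by norm_num, by norm_num⟩
      have h2 : 0 < α i / 2 * (1 / 2) * (1 - 1 / 2) * ‖x - y‖ ^ 2 := by
        have := norm_pos_iff.mpr hxy
        have := hα i
        norm_num
        positivity
      have h3 := hy i
      simp only at h1
      linarith
    · rintro ⟨y, hy⟩
      exact ⟨y, fun i => (hy i).le, ⟨0, hm⟩, hy _⟩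
  have hclosed : IsClosed (⋃ y, ⋂ i, {x | f y i < f x i})ᶜ := by
    rw [isClosed_compl_iff]
    exact isOpen_iUnion fun y => isOpen_iInter_of_finite fun i =>
      isOpen_lt continuous_const (hcont i)
  rw [heq]
  choose R hR using fun i => (hs i).exists_bound (hα i)
  refine (isCompact_closedBall (0 : EuclideanSpace ℝ (Fin n)) (∑ i, |R i|)).of_isClosed_subset
    hclosed ?_
  intro x hx
  simp only [Set.mem_compl_iff, Set.mem_iUnion, Set.mem_iInter, Set.mem_setOf_eq] at hx
  push Not at hx
  obtain ⟨i, hi⟩ := hx 0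
  have h1 := hR i x hi
  have h2 : |R i| ≤ ∑ i, |R i| :=
    Finset.single_le_sum (f := fun i => |R i|) (fun _ _ => abs_nonneg _) (Finset.mem_univ i)
  rw [mem_closedBall_zero_iff]
  exact h1.trans ((le_abs_self _).trans h2)
end

section
/- Let f = (f₁,…,f_m) : ℝⁿ → ℝᵐ be a strongly convex mapping, where each fᵢ is strongly convex with convexity parameter αᵢ > 0. Let α₀ = min{α₁,…,α_m}, and let K₀ ≥ 0 be such that |fᵢ(x) − fᵢ(y)| ≤ K₀ for all i ∈ {1,…,m} and all x, y ∈ X*(f). Then for any w = (w₁,…,w_m) and w̃ = (w̃₁,…,w̃_m) in Δ^{m−1}, ‖x*(w) − x*(w̃)‖ ≤ √((K₀/α₀) Σᵢ |wᵢ − w̃ᵢ|), where x*(w) denotes the unique minimizer of Σᵢ wᵢ fᵢ. -/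
open scoped BigOperators

/-- Quadratic growth of a weighted sum at its minimizer. -/
theorem growth_aux {n m : ℕ}
    (f : EuclideanSpace ℝ (Fin n) → Fin m → ℝ)
    (α : Fin m → ℝ)
    (hconv : ∀ i, StrongConvexWith (α i) (fun x => f x i))
    (α₀ : ℝ) (hle : ∀ i, α₀ ≤ α i)
    (w : Fin m → ℝ) (hw : w ∈ stdSimplex ℝ (Fin m)) (x : EuclideanSpace ℝ (Fin n))
    (hx : ∀ y, ∑ i, w i * f x i ≤ ∑ i, w i * f y i) (y : EuclideanSpace ℝ (Fin n)) :
    α₀ / 2 * ‖y - x‖ ^ 2 ≤ ∑ i, w i * f y i - ∑ i, w i * f x i := by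
  have key : ∀ t : ℝ, 0 < t → t ≤ 1 →
      α₀ / 2 * ‖y - x‖ ^ 2 * (1 - t) ≤ ∑ i, w i * f y i - ∑ i, w i * f x i := by
    intro t ht ht1
    have h1 := hx (t • y + (1 - t) • x)
    have h2 : ∑ i, w i * f (t • y + (1 - t) • x) i ≤
        ∑ i, (t * (w i * f y i) + (1 - t) * (w i * f x i)
          - w i * (α₀ / 2 * t * (1 - t) * ‖y - x‖ ^ 2)) := by
      apply Finset.sum_le_sum
      intro i _
      have h3 := hconv i y x t ⟨ht.le, ht1⟩
      have h4 : α₀ / 2 * t * (1 - t) * ‖y - x‖ ^ 2 ≤ α i / 2 * t * (1 - t) * ‖y - x‖ ^ 2 := by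
        have : 0 ≤ 1 - t := by linarith
        have := hle i
        gcongr
      have h5 : f (t • y + (1 - t) • x) i ≤
          t * f y i + (1 - t) * f x i - α₀ / 2 * t * (1 - t) * ‖y - x‖ ^ 2 := by
        simp only at h3
        linarith
      have := mul_le_mul_of_nonneg_left h5 (hw.1 i)
      linarith
    rw [Finset.sum_sub_distrib, Finset.sum_add_distrib, ← Finset.mul_sum, ← Finset.mul_sum,
      ← Finset.sum_mul, hw.2] at h2
    refine le_of_mul_le_mul_left ?_ ht
    linarith
  set c := α₀ / 2 * ‖y - x‖ ^ 2
  set g := ∑ i, w i * f y i - ∑ i, w i * f x i with hg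
  have g0 : 0 ≤ g := by have := hx y; linarith
  by_contra! h
  have hc : 0 < c := by linarith
  have := key ((c - g) / (2 * c)) (by apply div_pos <;> linarith)
    (by rw [div_le_one (by linarith)]; linarith)
  have e : c * (1 - (c - g) / (2 * c)) = (c + g) / 2 := by
    field_simp
    ring
  rw [e] at this
  linarith

/-- Minimizers of weighted sums are Pareto solutions. -/
theorem pareto_aux {n m : ℕ}
    (f : EuclideanSpace ℝ (Fin n) → Fin m → ℝ)
    (α : Fin m → ℝ)
    (hconv : ∀ i, StrongConvexWith (α i) (fun x => f x i))
    (α₀ : ℝ) (hpos : 0 < α₀) (hle : ∀ i, α₀ ≤ α i)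
    (w : Fin m → ℝ) (hw : w ∈ stdSimplex ℝ (Fin m)) (x : EuclideanSpace ℝ (Fin n))
    (hx : ∀ y, ∑ i, w i * f x i ≤ ∑ i, w i * f y i) : x ∈ ParetoSet f := by
  rintro ⟨y, hy, j, hj⟩
  have h1 := growth_aux f α hconv α₀ hle w hw x hx y
  have h2 : ∑ i, w i * f y i ≤ ∑ i, w i * f x i :=
    Finset.sum_le_sum fun i _ => mul_le_mul_of_nonneg_left (hy i) (hw.1 i)
  have hne : y ≠ x := by
    rintro rfl
    exact lt_irrefl _ hj
  have : 0 < ‖y - x‖ := norm_pos_iff.2 (sub_ne_zero.2 hne)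
  have : 0 < α₀ / 2 * ‖y - x‖ ^ 2 := by positivity
  linarith

/-- Hölder-type estimate for the solution map of a strongly convex problem:
`‖x*(w) − x*(w̃)‖ ≤ √((K₀/α₀) Σᵢ |wᵢ − w̃ᵢ|)`, where `α₀ = min αᵢ` and `K₀` bounds
`|fᵢ(x) − fᵢ(y)|` on the Pareto set. -/
theorem solution_map_holder {n m : ℕ}
    (f : EuclideanSpace ℝ (Fin n) → Fin m → ℝ)
    (α : Fin m → ℝ) (hα : ∀ i, 0 < α i)
    (hconv : ∀ i, StrongConvexWith (α i) (fun x => f x i))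
    (α₀ : ℝ) (hα₀ : IsLeast (Set.range α) α₀)
    (K₀ : ℝ) (hK₀ : 0 ≤ K₀)
    (hK : ∀ i, ∀ x ∈ ParetoSet f, ∀ y ∈ ParetoSet f, |f x i - f y i| ≤ K₀)
    (xStar : (Fin m → ℝ) → EuclideanSpace ℝ (Fin n))
    (hxStar : ∀ w ∈ stdSimplex ℝ (Fin m),
      ∀ y, ∑ i, w i * f (xStar w) i ≤ ∑ i, w i * f y i) :
    ∀ w ∈ stdSimplex ℝ (Fin m), ∀ w' ∈ stdSimplex ℝ (Fin m),
      ‖xStar w - xStar w'‖ ≤ Real.sqrt (K₀ / α₀ * ∑ i, |w i - w' i|) := by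
  intro w hw w' hw'
  have hle : ∀ i, α₀ ≤ α i := fun i => hα₀.2 ⟨i, rfl⟩
  have hpos : 0 < α₀ := by
    obtain ⟨i, hi⟩ := hα₀.1
    rw [← hi]
    exact hα i
  have p := pareto_aux f α hconv α₀ hpos hle w hw _ (hxStar w hw)
  have p' := pareto_aux f α hconv α₀ hpos hle w' hw' _ (hxStar w' hw')
  have g := growth_aux f α hconv α₀ hle w hw _ (hxStar w hw) (xStar w')
  have g' := growth_aux f α hconv α₀ hle w' hw' _ (hxStar w' hw') (xStar w)
  rw [norm_sub_rev] at g
  have hs : ∑ i, (w i - w' i) * (f (xStar w') i - f (xStar w) i) ≤ ∑ i, K₀ * |w i - w' i| := by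
    apply Finset.sum_le_sum
    intro i _
    calc _ ≤ |(w i - w' i) * (f (xStar w') i - f (xStar w) i)| := le_abs_self _
      _ = |f (xStar w') i - f (xStar w) i| * |w i - w' i| := by rw [abs_mul, mul_comm]
      _ ≤ _ := mul_le_mul_of_nonneg_right (hK i _ p' _ p) (abs_nonneg _)
  rw [← Finset.mul_sum] at hs
  simp only [sub_mul, mul_sub, Finset.sum_sub_distrib] at hs
  apply Real.le_sqrt_of_sq_le
  rw [div_mul_eq_mul_div, le_div_iff₀ hpos]
  linarith
end

section
/- Let f₁, f₂ : ℝ → ℝ be defined by f₁(x) = x² + |x| and f₂(x) = (x−1)² + |x−1|. Then f₁ and f₂ are strongly convex, and for each w₁ ∈ [0,1] the unique minimizer of the function w₁ f₁ + (1 − w₁) f₂ equals 1 if 0 ≤ w₁ < 1/4, equals (3 − 4w₁)/2 if 1/4 ≤ w₁ ≤ 3/4, and equals 0 if 3/4 < w₁ ≤ 1. In particular, the map x* : Δ¹ → X*((f₁,f₂)) sending w to the unique minimizer of w₁ f₁ + w₂ f₂ is not injective. -/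
/-- `f : ℝ → ℝ` is strongly convex with convexity parameter `α`. -/
def StrongConvexWith1 (α : ℝ) (f : ℝ → ℝ) : Prop :=
  ∀ x y : ℝ, ∀ t ∈ Set.Icc (0 : ℝ) 1,
    f (t * x + (1 - t) * y) ≤
      t * f x + (1 - t) * f y - α / 2 * t * (1 - t) * |x - y| ^ 2

lemma abs_conv (x y t : ℝ) (h0 : 0 ≤ t) (h1 : t ≤ 1) :
    |t * x + (1 - t) * y| ≤ t * |x| + (1 - t) * |y| := by
  have h := abs_add_le (t * x) ((1 - t) * y)
  rwa [abs_mul, abs_mul, abs_of_nonneg h0, abs_of_nonneg (sub_nonneg.2 h1)] at h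

/-- The candidate minimizer. -/
noncomputable def mm (w : ℝ) : ℝ :=
  if w < 1 / 4 then 1 else if w ≤ 3 / 4 then (3 - 4 * w) / 2 else 0

/-- Quadratic growth at the candidate minimizer. -/
lemma growth (w y : ℝ) (h0 : 0 ≤ w) (h1 : w ≤ 1) :
    w * (mm w ^ 2 + |mm w|) + (1 - w) * ((mm w - 1) ^ 2 + |mm w - 1|) + (y - mm w) ^ 2
      ≤ w * (y ^ 2 + |y|) + (1 - w) * ((y - 1) ^ 2 + |y - 1|) := by
  have a1 : w * y ≤ w * |y| := mul_le_mul_of_nonneg_left (le_abs_self y) h0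
  have a2 : w * (-y) ≤ w * |y| := mul_le_mul_of_nonneg_left (neg_le_abs y) h0
  have b1 : (1 - w) * (y - 1) ≤ (1 - w) * |y - 1| :=
    mul_le_mul_of_nonneg_left (le_abs_self _) (by linarith)
  have b2 : (1 - w) * (-(y - 1)) ≤ (1 - w) * |y - 1| :=
    mul_le_mul_of_nonneg_left (neg_le_abs _) (by linarith)
  unfold mm
  split_ifs with c1 c2
  · norm_num
    rcases le_total 1 y with h | h
    · nlinarith
    · nlinarith
  · rw [abs_of_nonneg (by linarith : 0 ≤ (3 - 4 * w) / 2),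
      abs_of_nonpos (by linarith : (3 - 4 * w) / 2 - 1 ≤ 0)]
    nlinarith
  · norm_num
    rcases le_total 0 y with h | h
    · nlinarith
    · nlinarith

/-- For `f₁(x) = x² + |x|` and `f₂(x) = (x−1)² + |x−1|`: both are strongly convex; for
each `w₁ ∈ [0,1]` the function `w₁ f₁ + (1−w₁) f₂` has a unique minimizer, equal to `1`
if `w₁ < 1/4`, to `(3−4w₁)/2` if `1/4 ≤ w₁ ≤ 3/4`, and to `0` if `3/4 < w₁`; in
particular the solution map `x* : Δ¹ → X*((f₁,f₂))` is not injective. -/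
theorem solution_map_not_injective (f₁ f₂ : ℝ → ℝ)
    (hf₁ : ∀ x, f₁ x = x ^ 2 + |x|) (hf₂ : ∀ x, f₂ x = (x - 1) ^ 2 + |x - 1|) :
    (∃ α > (0 : ℝ), StrongConvexWith1 α f₁) ∧
    (∃ α > (0 : ℝ), StrongConvexWith1 α f₂) ∧
    (∀ w₁ ∈ Set.Icc (0 : ℝ) 1,
      ∃! x : ℝ, ∀ y, w₁ * f₁ x + (1 - w₁) * f₂ x ≤ w₁ * f₁ y + (1 - w₁) * f₂ y) ∧
    (∀ w₁ ∈ Set.Icc (0 : ℝ) 1, ∀ x : ℝ,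
      (∀ y, w₁ * f₁ x + (1 - w₁) * f₂ x ≤ w₁ * f₁ y + (1 - w₁) * f₂ y) →
        x = if w₁ < 1 / 4 then 1 else if w₁ ≤ 3 / 4 then (3 - 4 * w₁) / 2 else 0) ∧
    ∀ xStar : (Fin 2 → ℝ) → ℝ,
      (∀ w ∈ stdSimplex ℝ (Fin 2), ∀ y,
        w 0 * f₁ (xStar w) + w 1 * f₂ (xStar w) ≤ w 0 * f₁ y + w 1 * f₂ y) →
      ¬ Set.InjOn xStar (stdSimplex ℝ (Fin 2)) := by
  have G : ∀ w₁ ∈ Set.Icc (0 : ℝ) 1, ∀ y,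
      w₁ * f₁ (mm w₁) + (1 - w₁) * f₂ (mm w₁) + (y - mm w₁) ^ 2
        ≤ w₁ * f₁ y + (1 - w₁) * f₂ y := by
    intro w hw y
    simp only [hf₁, hf₂]
    exact growth w y hw.1 hw.2
  have U : ∀ w₁ ∈ Set.Icc (0 : ℝ) 1, ∀ x : ℝ,
      (∀ y, w₁ * f₁ x + (1 - w₁) * f₂ x ≤ w₁ * f₁ y + (1 - w₁) * f₂ y) → x = mm w₁ := by
    intro w hw x hx
    have h := G w hw x
    have h' := hx (mm w)
    have : (x - mm w) ^ 2 = 0 := le_antisymm (by linarith) (sq_nonneg _)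
    exact sub_eq_zero.1 (pow_eq_zero_iff two_ne_zero |>.1 this)
  refine ⟨⟨2, by norm_num, ?_⟩, ⟨2, by norm_num, ?_⟩, ?_, U, ?_⟩
  · intro x y t ht
    rw [hf₁, hf₁, hf₁, sq_abs]
    have h := abs_conv x y t ht.1 ht.2
    linarith
  · intro x y t ht
    rw [hf₂, hf₂, hf₂, sq_abs]
    have h := abs_conv (x - 1) (y - 1) t ht.1 ht.2
    rw [show t * (x - 1) + (1 - t) * (y - 1) = t * x + (1 - t) * y - 1 by ring] at h
    linarith
  · intro w hw
    refine ⟨mm w, fun y => ?_, fun x hx => U w hw x hx⟩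
    have := G w hw y
    have := sq_nonneg (y - mm w)
    linarith
  · intro X hX hinj
    have key : ∀ a : ℝ, 0 ≤ a → a < 1 / 4 →
        (![a, 1 - a] ∈ stdSimplex ℝ (Fin 2)) ∧ X ![a, 1 - a] = 1 := by
      intro a h0 h1
      have hm : ![a, 1 - a] ∈ stdSimplex ℝ (Fin 2) := by
        refine ⟨fun i => ?_, by simp [Fin.sum_univ_two]⟩
        fin_cases i
        · simpa using h0
        · simp; linarith
      refine ⟨hm, ?_⟩
      have := U a ⟨h0, by linarith⟩ (X ![a, 1 - a]) (by simpa using hX _ hm)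
      rw [this, mm, if_pos h1]
    obtain ⟨m1, e1⟩ := key 0 (by norm_num) (by norm_num)
    obtain ⟨m2, e2⟩ := key (1 / 8) (by norm_num) (by norm_num)
    have := congrFun (hinj m1 m2 (e1.trans e2.symm)) 0
    norm_num at this
end
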